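/- Let G∞, G_f be groups, G = G∞ × G_f, and Γ ≤ G a subgroup with Γ ∩ ({1} × G_f) = {1}. Let U ≤ {1} × G_f be a subgroup, let h = (1, h_f) ∈ {1} × G_f, and set U(h) = U ∩ hUh⁻¹. Then the map sending Γ g U(h) to (Γ×Γ)(g, gh)(U×U) is a well-defined injection from Γ\G/U(h) into (Γ×Γ)\(G×G)/(U×U). -/

import Mathlib

/-- The double coset `H x K` of `x` with respect to two subsets `H, K` of a group. -/
def doubleCoset {G : Type*} [Group G] (H K : Set G) (x : G) : Set G :=
  {y | ∃ h ∈ H, ∃ k ∈ K, y = h * x * k}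

theorem doubleCoset_eq_iff {G : Type*} [Group G] (H K : Subgroup G) (x y : G) :
    doubleCoset (H : Set G) (K : Set G) x = doubleCoset (H : Set G) (K : Set G) y ↔
      ∃ h ∈ H, ∃ k ∈ K, x = h * y * k := by
  have h_eq (z : G) : doubleCoset (H : Set G) (K : Set G) z = DoubleCoset.doubleCoset z H K := by
    ext w
    exact DoubleCoset.mem_doubleCoset.symm
  rw [h_eq, h_eq]
  exact eq_comm.trans DoubleCoset.rel_iff

/-- If `Γ ∩ ({1} × G_f) = {1}`, `U ≤ {1} × G_f`, and
`h = (1, h_f)`, then `Γ g U(h) ↦ (Γ×Γ)(g, gh)(U×U)` is a well-defined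
injection from `Γ\G/U(h)` into `(Γ×Γ)\(G×G)/(U×U)`. -/
theorem hecke_graph_injective
    {Ginf Gf : Type*} [Group Ginf] [Group Gf]
    (Γ : Subgroup (Ginf × Gf)) (U : Subgroup (Ginf × Gf))
    (hΓ : ∀ γ ∈ Γ, γ.1 = 1 → γ = 1)
    (hU : ∀ u ∈ U, u.1 = 1)
    (hf : Gf) :
    ∀ g g' : Ginf × Gf,
      doubleCoset ((Γ.prod Γ : Subgroup ((Ginf × Gf) × (Ginf × Gf))) :
            Set ((Ginf × Gf) × (Ginf × Gf)))
          ((U.prod U : Subgroup ((Ginf × Gf) × (Ginf × Gf))) :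
            Set ((Ginf × Gf) × (Ginf × Gf)))
          (g, g * ((1 : Ginf), hf))
        = doubleCoset ((Γ.prod Γ : Subgroup ((Ginf × Gf) × (Ginf × Gf))) :
              Set ((Ginf × Gf) × (Ginf × Gf)))
            ((U.prod U : Subgroup ((Ginf × Gf) × (Ginf × Gf))) :
              Set ((Ginf × Gf) × (Ginf × Gf)))
            (g', g' * ((1 : Ginf), hf))
      ↔ doubleCoset (Γ : Set (Ginf × Gf))
            ((U : Set (Ginf × Gf)) ∩
              ((fun u => ((1 : Ginf), hf) * u * ((1 : Ginf), hf)⁻¹) '' (U : Set (Ginf × Gf)))) g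
          = doubleCoset (Γ : Set (Ginf × Gf))
              ((U : Set (Ginf × Gf)) ∩
                ((fun u => ((1 : Ginf), hf) * u * ((1 : Ginf), hf)⁻¹) '' (U : Set (Ginf × Gf)))) g' := by
  intro g g'
  set h : Ginf × Gf := (1, hf)
  have h_level : (U : Set (Ginf × Gf)) ∩ ((fun u => h * u * h⁻¹) '' (U : Set (Ginf × Gf))) =
      ((U ⊓ U.map (MulAut.conj h).toMonoidHom : Subgroup (Ginf × Gf)) : Set (Ginf × Gf)) := rfl
  rw [h_level, doubleCoset_eq_iff, doubleCoset_eq_iff]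
  constructor
  · rintro ⟨⟨γ₁, γ₂⟩, ⟨hγ₁, hγ₂⟩, ⟨u₁, u₂⟩, ⟨hu₁, hu₂⟩, heq⟩
    obtain ⟨e₁, e₂⟩ : g = γ₁ * g' * u₁ ∧ g * h = γ₂ * (g' * h) * u₂ := Prod.ext_iff.mp heq
    have h_fst : γ₁.1 = γ₂.1 := by
      have e := e₂
      rw [e₁] at e
      simpa [h, hU u₁ hu₁, hU u₂ hu₂] using congrArg Prod.fst e
    obtain rfl : γ₁ = γ₂ := mul_inv_eq_one.mp <|
      hΓ _ (Γ.mul_mem hγ₁ (Γ.inv_mem hγ₂)) (by simp [h_fst])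
    refine ⟨γ₁, hγ₁, u₁, ⟨hu₁, u₂, hu₂, ?_⟩, e₁⟩
    change h * u₂ * h⁻¹ = u₁
    rw [e₁] at e₂
    simp only [mul_assoc, mul_right_inj] at e₂
    rw [← e₂, mul_inv_cancel_right]
  · rintro ⟨γ, hγ, _, ⟨hu, v, hv, rfl⟩, rfl⟩
    refine ⟨(γ, γ), ⟨hγ, hγ⟩, (h * v * h⁻¹, v), ⟨hu, hv⟩, Prod.ext rfl ?_⟩
    change γ * g' * (h * v * h⁻¹) * h = γ * (g' * h) * v
    group
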